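/- Let n ≥ 2 and let f : {1,−1}^n → ℝ have all influences I_j ≥ 0. Assume κ, δ > 0 and that for each 1 ≤ j < n one has f|_{ε_j=1, ε_{j+1}=1} − f|_{ε_j=−1, ε_{j+1}=−1} ≥ κ for all ε in a set Ω_j ⊆ {1,−1}^n depending only on the variables ε_{j+2},…,ε_n and satisfying mes Ω_j > 1 − δ. Then there is an absolute constant C such that for every t ∈ ℝ, mes[ ε : |f(ε) − t| < κ/2 ] ≤ C (1/√n + nδ). -/

import Mathlib

noncomputable section

/-- Uniform measure of a subset of the Boolean cube `{1,-1}^n`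
(encoded as `Fin n → Bool`, with `true ↔ 1` and `false ↔ -1`). -/
def mes {n : ℕ} (S : Set (Fin n → Bool)) : ℝ := by
  classical exact ((Finset.univ.filter fun ε => ε ∈ S).card : ℝ) / 2 ^ n

/-- The `j`-th influence of `f : {1,-1}^n → ℝ`:
`I_j(ε) = f|_{ε_j = 1} - f|_{ε_j = -1}`. -/
def influence {n : ℕ} (f : (Fin n → Bool) → ℝ) (j : Fin n) (ε : Fin n → Bool) : ℝ :=
  f (Function.update ε j true) - f (Function.update ε j false)

/-- The pair influence of the consecutive coordinates `j, j+1`: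
`f|_{ε_j = 1, ε_{j+1} = 1} - f|_{ε_j = -1, ε_{j+1} = -1}`. -/
def pairInfluence {n : ℕ} (f : (Fin n → Bool) → ℝ) (j j' : Fin n)
    (ε : Fin n → Bool) : ℝ :=
  f (Function.update (Function.update ε j true) j' true) -
    f (Function.update (Function.update ε j false) j' false)

/-- `S ⊆ {1,-1}^n` depends only on the variables `ε_k` for `k > j`. -/
def DependsOnGt {n : ℕ} (S : Set (Fin n → Bool)) (j : Fin n) : Prop :=
  ∀ ε ε' : Fin n → Bool, (∀ k : Fin n, j < k → ε k = ε' k) → (ε ∈ S ↔ ε' ∈ S)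

/-- A function on the cube with nonnegative influences is monotone. -/
lemma monotone_of_influence_nonneg {n : ℕ} {f : (Fin n → Bool) → ℝ}
    (hf : ∀ (j : Fin n) (ε : Fin n → Bool), 0 ≤ influence f j ε) : Monotone f := by
  intro x y hxy
  have update_le : ∀ (z : Fin n → Bool) (j : Fin n) (b : Bool), z j ≤ b →
      f z ≤ f (Function.update z j b) := by
    intro z j b hb
    have h := hf j z
    unfold influence at h
    rcases eq_or_lt_of_le hb with h1 | h1
    · rw [← h1, Function.update_eq_self]
    · obtain ⟨h2, h3⟩ := Bool.lt_iff.mp h1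
      have h4 : Function.update z j false = z := by
        rw [← h2, Function.update_eq_self]
      rw [h4] at h
      rw [h3]
      linarith
  have key : ∀ s : Finset (Fin n), f x ≤ f (s.piecewise y x) := by
    intro s
    induction s using Finset.induction_on with
    | empty => simp
    | insert j s hj ih =>
      rw [Finset.piecewise_insert]
      refine ih.trans (update_le _ _ _ ?_)
      rw [Finset.piecewise_eq_of_notMem _ _ _ hj]
      exact hxy j
  simpa using key Finset.univ

/-- If `x ≤ y` and the pair `(j, j')` is raised from `(-1, -1)` to `(1, 1)`, then a monotone
function grows by at least the pair influence. -/
lemma add_pairInfluence_le {n : ℕ} {f : (Fin n → Bool) → ℝ} (hf : Monotone f)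
    {x y : Fin n → Bool} (hxy : x ≤ y) {j j' : Fin n}
    (hx : x j = false) (hx' : x j' = false) (hy : y j = true) (hy' : y j' = true) :
    f x + pairInfluence f j j' x ≤ f y := by
  have h0 : Function.update (Function.update x j false) j' false = x := by
    rw [← hx, Function.update_eq_self, hx, ← hx', Function.update_eq_self]
  have h1 : Function.update (Function.update x j true) j' true ≤ y := by
    rw [update_le_iff]
    refine ⟨hy'.ge, fun k _ => ?_⟩
    by_cases hk : k = j
    · subst hk; simp [hy]
    · rw [Function.update_of_ne hk]; exact hxy k
  have h2 := hf h1
  unfold pairInfluence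
  rw [h0]
  linarith

lemma centralBinom_sq_mul_le (j : ℕ) : j.centralBinom ^ 2 * (2 * j + 1) ≤ 16 ^ j := by
  induction j with
  | zero => simp
  | succ j ih =>
    have h := Nat.succ_mul_centralBinom_succ j
    have h2 : (j + 1) ^ 2 * ((j + 1).centralBinom ^ 2 * (2 * (j + 1) + 1))
        ≤ (j + 1) ^ 2 * 16 ^ (j + 1) := by
      calc (j + 1) ^ 2 * ((j + 1).centralBinom ^ 2 * (2 * (j + 1) + 1))
          = ((j + 1) * (j + 1).centralBinom) ^ 2 * (2 * j + 3) := by ring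
        _ = 4 * (2 * j + 1) * (2 * j + 3) * (j.centralBinom ^ 2 * (2 * j + 1)) := by
          rw [h]; ring
        _ ≤ 4 * (2 * j + 1) * (2 * j + 3) * 16 ^ j := Nat.mul_le_mul_left _ ih
        _ ≤ (16 * (j + 1) ^ 2) * 16 ^ j := Nat.mul_le_mul_right _ (by nlinarith)
        _ = _ := by ring
    exact Nat.le_of_mul_le_mul_left h2 (by positivity)

lemma choose_half_sq_mul_le (k : ℕ) : (k.choose (k / 2)) ^ 2 * (k + 1) ≤ 4 ^ k := by
  obtain ⟨j, rfl | rfl⟩ := Nat.even_or_odd' k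
  · have h := centralBinom_sq_mul_le j
    rw [Nat.centralBinom] at h
    rw [pow_mul, Nat.mul_div_cancel_left _ two_pos]
    exact h
  · have h := centralBinom_sq_mul_le (j + 1)
    have h1 : (j + 1).centralBinom = 2 * (2 * j + 1).choose j := by
      rw [Nat.centralBinom, show 2 * (j + 1) = 2 * j + 1 + 1 by ring, Nat.choose_succ_succ,
        Nat.choose_symm_half]
      ring
    rw [h1] at h
    rw [show (2 * j + 1) / 2 = j by omega]
    have h2 : (4 : ℕ) ^ (2 * j + 1) * 4 = 16 ^ (j + 1) := by
      rw [← pow_succ, show 2 * j + 1 + 1 = 2 * (j + 1) by ring, pow_mul]; norm_num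
    nlinarith

lemma choose_half_le (k : ℕ) : (k.choose (k / 2) : ℝ) ≤ 2 ^ k / √(k + 1) := by
  rw [le_div_iff₀ (by positivity)]
  refine le_of_sq_le_sq ?_ (by positivity)
  rw [mul_pow, Real.sq_sqrt (by positivity), ← pow_mul, mul_comm k 2, pow_mul]
  have := choose_half_sq_mul_le k
  norm_num
  exact_mod_cast this

lemma sum_inv_card_add_one_le (m : ℕ) :
    ∑ S : Finset (Fin m), 1 / ((S.card : ℝ) + 1) ≤ 2 * 2 ^ m / (m + 1) := by
  rw [← Finset.powerset_univ, Finset.sum_powerset_apply_card (fun k => 1 / ((k : ℝ) + 1)),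
    Finset.card_univ, Fintype.card_fin]
  have h1 : ∀ k ∈ Finset.range (m + 1), m.choose k • (1 / ((k : ℝ) + 1)) =
      ((m + 1).choose (k + 1) : ℝ) / (m + 1) := by
    intro k _
    have h : ((m : ℝ) + 1) * m.choose k = (m + 1).choose (k + 1) * (k + 1) := by
      exact_mod_cast Nat.add_one_mul_choose_eq m k
    rw [nsmul_eq_mul]
    field_simp
    linarith
  rw [Finset.sum_congr rfl h1, ← Finset.sum_div]
  gcongr
  have h2 := Nat.sum_range_choose (m + 1)
  rw [Finset.sum_range_succ'] at h2
  have h3 : (∑ k ∈ Finset.range (m + 1), ((m + 1).choose (k + 1) : ℝ)) + 1 = 2 ^ (m + 1) := by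
    exact_mod_cast h2
  rw [pow_succ] at h3
  linarith

lemma sum_inv_sqrt_card_add_one_le (m : ℕ) :
    ∑ S : Finset (Fin m), 1 / √((S.card : ℝ) + 1) ≤ 3 / 2 * 2 ^ m / √(m + 1) := by
  set a := √((m : ℝ) + 1) with ha
  have ha0 : 0 < a := by positivity
  have hterm : ∀ S : Finset (Fin m),
      1 / √((S.card : ℝ) + 1) ≤ a / 2 * (1 / ((S.card : ℝ) + 1)) + 1 / (2 * a) := by
    intro S
    set b := √((S.card : ℝ) + 1) with hb
    have hb0 : 0 < b := by positivity
    have hb2 : (S.card : ℝ) + 1 = b ^ 2 := by rw [hb, Real.sq_sqrt (by positivity)]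
    rw [hb2]
    have : a / 2 * (1 / b ^ 2) + 1 / (2 * a) - 1 / b = (a - b) ^ 2 / (2 * a * b ^ 2) := by
      field_simp
      ring
    have h2 : 0 ≤ (a - b) ^ 2 / (2 * a * b ^ 2) :=
      div_nonneg (sq_nonneg _) (mul_nonneg (mul_nonneg zero_le_two ha0.le) (sq_nonneg _))
    linarith
  have h := sum_inv_card_add_one_le m
  have ha2 : (m : ℝ) + 1 = a ^ 2 := by rw [ha, Real.sq_sqrt (by positivity)]
  rw [ha2] at h
  calc _ ≤ ∑ S : Finset (Fin m), (a / 2 * (1 / ((S.card : ℝ) + 1)) + 1 / (2 * a)) :=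
        Finset.sum_le_sum fun S _ => hterm S
    _ = a / 2 * ∑ S : Finset (Fin m), (1 / ((S.card : ℝ) + 1)) + 2 ^ m * (1 / (2 * a)) := by
        rw [Finset.sum_add_distrib, ← Finset.mul_sum]
        simp
    _ ≤ a / 2 * (2 * 2 ^ m / a ^ 2) + 2 ^ m * (1 / (2 * a)) := by gcongr
    _ = _ := by field_simp; ring

/-- A Sperner-type bound: the coordinates of the cube are covered by the pairs `(p i, q i)` and one
extra coordinate `l`, and no two points `x ≤ y` of `A` differ by raising a whole pair. -/
lemma card_le_of_no_raised_pair {n m : ℕ} (p q : Fin m → Fin n) (l : Fin n)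
    (hcover : ∀ k, k = l ∨ ∃ i, k = p i ∨ k = q i) (A : Finset (Fin n → Bool))
    (hA : ∀ x ∈ A, ∀ y ∈ A, x ≤ y → ∀ i, x (p i) = false → x (q i) = false →
      y (p i) = true → y (q i) = true → False) :
    (A.card : ℝ) ≤ 3 * 4 ^ m / √(m + 1) := by
  classical
  let S : (Fin n → Bool) → Finset (Fin m) := fun x => {i | x (p i) = x (q i)}
  let T : (Fin n → Bool) → Finset (Fin m) := fun x => {i | x (p i) = true}
  have hS : ∀ x i, i ∈ S x ↔ x (p i) = x (q i) := fun x i => by simp [S]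
  have hT : ∀ x i, i ∈ T x ↔ x (p i) = true := fun x i => by simp [T]
  let K : Finset (Σ _ : Finset (Fin m), Finset (Fin m) × Bool) :=
    Finset.univ.sigma fun s => (sᶜ).powerset ×ˢ Finset.univ
  have hfiber := Finset.card_eq_sum_card_fiberwise
    (f := fun x => (⟨S x, T x \ S x, x l⟩ : Σ _ : Finset (Fin m), Finset (Fin m) × Bool))
    (s := A) (t := K) (by
      intro x _
      simp only [K, Finset.coe_sigma, Set.mem_sigma_iff, Finset.mem_coe, Finset.mem_univ, true_and,
        Finset.mem_product, Finset.mem_powerset, and_true]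
      intro i hi
      simp only [Finset.mem_sdiff] at hi
      simpa using hi.2)
  have hbound : ∀ k ∈ K, (A.filter fun x =>
      (⟨S x, T x \ S x, x l⟩ : Σ _ : Finset (Fin m), Finset (Fin m) × Bool) = k).card ≤
        k.1.card.choose (k.1.card / 2) := by
    rintro ⟨s, r, b⟩ -
    set F := A.filter fun x =>
      (⟨S x, T x \ S x, x l⟩ : Σ _ : Finset (Fin m), Finset (Fin m) × Bool) = ⟨s, r, b⟩ with hF
    have hmem : ∀ x ∈ F, x ∈ A ∧ S x = s ∧ T x \ S x = r ∧ x l = b := by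
      intro x hx
      simpa [hF] using hx
    let g : (Fin n → Bool) → Finset {i // i ∈ s} := fun x => (T x).subtype (· ∈ s)
    have hle : ∀ x ∈ F, ∀ y ∈ F, g x ⊆ g y → x ≤ y := by
      intro x hx y hy hg
      obtain ⟨-, hx1, hx2, hx3⟩ := hmem x hx
      obtain ⟨-, hy1, hy2, hy3⟩ := hmem y hy
      have hp : ∀ i, x (p i) = true → y (p i) = true := by
        intro i hi
        by_cases his : i ∈ s
        · have : (⟨i, his⟩ : {i // i ∈ s}) ∈ g x := by simpa [g, hT] using hi
          simpa [g, hT] using hg this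
        · have : i ∈ T x \ S x := by
            rw [Finset.mem_sdiff, hT, hx1]; exact ⟨hi, his⟩
          rw [hx2, ← hy2, Finset.mem_sdiff, hT] at this
          exact this.1
      have hp' : ∀ i, i ∉ s → y (p i) = true → x (p i) = true := by
        intro i his hi
        have : i ∈ T y \ S y := by
          rw [Finset.mem_sdiff, hT, hy1]; exact ⟨hi, his⟩
        rw [hy2, ← hx2, Finset.mem_sdiff, hT] at this
        exact this.1
      intro k
      rcases hcover k with rfl | ⟨i, rfl | rfl⟩
      · rw [hx3, hy3]
      · exact Bool.le_iff_imp.mpr (hp i)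
      · have hxs := hS x i
        have hys := hS y i
        rw [hx1] at hxs
        rw [hy1] at hys
        by_cases his : i ∈ s
        · rw [← hxs.mp his, ← hys.mp his]
          exact Bool.le_iff_imp.mpr (hp i)
        · have h1 := hp i
          have h2 := hp' i his
          have h3 := mt hxs.mpr his
          have h4 := mt hys.mpr his
          revert h1 h2 h3 h4
          cases x (p i) <;> cases x (q i) <;> cases y (p i) <;> cases y (q i) <;> simp
    have hinj : Set.InjOn g F := fun x hx y hy hxy =>
      le_antisymm (hle x hx y hy hxy.le) (hle y hy x hx hxy.ge)
    have hanti : IsAntichain (· ⊆ ·) (F.image g : Set (Finset {i // i ∈ s})) := by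
      intro u hu v hv huv hsub
      rw [Finset.mem_coe, Finset.mem_image] at hu hv
      obtain ⟨x, hx, rfl⟩ := hu
      obtain ⟨y, hy, rfl⟩ := hv
      obtain ⟨⟨i, his⟩, hi, hi'⟩ := Finset.exists_of_ssubset (hsub.ssubset_of_ne huv)
      have hyp : y (p i) = true := by simpa [g, hT] using hi
      have hxp : x (p i) = false := by simpa [g, hT] using hi'
      obtain ⟨hxA, hx1, -⟩ := hmem x hx
      obtain ⟨hyA, hy1, -⟩ := hmem y hy
      exact hA x hxA y hyA (hle x hx y hy hsub) i hxp
        (((hS x i).mp (hx1 ▸ his)).symm.trans hxp) hyp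
        (((hS y i).mp (hy1 ▸ his)).symm.trans hyp)
    have h := hanti.sperner
    rwa [Finset.card_image_of_injOn hinj, Fintype.card_coe] at h
  have hcount : A.card ≤ ∑ s : Finset (Fin m),
      2 ^ (m - s.card) * 2 * s.card.choose (s.card / 2) := by
    refine hfiber.trans_le ((Finset.sum_le_sum hbound).trans_eq ?_)
    rw [Finset.sum_sigma]
    refine Finset.sum_congr rfl fun s _ => ?_
    simp [Finset.card_product, Finset.card_powerset, Finset.card_compl]
  calc (A.card : ℝ)
      ≤ ∑ s : Finset (Fin m), (2 : ℝ) ^ (m - s.card) * 2 * s.card.choose (s.card / 2) := by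
        exact_mod_cast hcount
    _ ≤ ∑ s : Finset (Fin m), 2 * 2 ^ m * (1 / √((s.card : ℝ) + 1)) := by
        refine Finset.sum_le_sum fun s _ => ?_
        have hs : s.card ≤ m := by simpa using s.card_le_univ
        calc (2 : ℝ) ^ (m - s.card) * 2 * s.card.choose (s.card / 2)
            ≤ 2 ^ (m - s.card) * 2 * (2 ^ s.card / √((s.card : ℝ) + 1)) := by
              gcongr
              exact choose_half_le _
          _ = 2 * (2 ^ (m - s.card) * 2 ^ s.card) * (1 / √((s.card : ℝ) + 1)) := by ring
          _ = _ := by rw [← pow_add, Nat.sub_add_cancel hs]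
    _ = 2 * 2 ^ m * ∑ s : Finset (Fin m), (1 / √((s.card : ℝ) + 1)) := by
        rw [Finset.mul_sum]
    _ ≤ 2 * 2 ^ m * (3 / 2 * 2 ^ m / √(m + 1)) := by
        gcongr
        exact sum_inv_sqrt_card_add_one_le m
    _ = 3 * 4 ^ m / √(m + 1) := by
        rw [show (4 : ℝ) = 2 * 2 by norm_num, mul_pow]; ring

lemma card_filter_notMem_le_of_lt_mes {n : ℕ} {S : Set (Fin n → Bool)} [DecidablePred (· ∈ S)]
    {δ : ℝ} (h : 1 - δ < mes S) :
    ((Finset.univ.filter fun ε => ε ∉ S).card : ℝ) ≤ δ * 2 ^ n := by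
  have h1 := Finset.card_filter_add_card_filter_not (s := (Finset.univ : Finset (Fin n → Bool)))
    (fun ε => ε ∈ S)
  have h2 : ((Finset.univ.filter fun ε => ε ∈ S).card : ℝ) +
      (Finset.univ.filter fun ε => ε ∉ S).card = 2 ^ n := by
    rw [← Nat.cast_add, h1]; simp
  have h3 : mes S = ((Finset.univ.filter fun ε => ε ∈ S).card : ℝ) / 2 ^ n := by
    unfold mes
    congr!
  rw [h3, lt_div_iff₀ (by positivity)] at h
  linarith

/-- **Lemma 2.** If all influences of `f` are nonnegative and for each `j < n`
the pair influence of `(ε_j, ε_{j+1})` is `≥ κ` on a set `Ω_j` depending only on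
`ε_{j+2},…,ε_n` with `mes Ω_j > 1 - δ`, then for every `t`,
`mes[|f - t| < κ/2] ≤ C (1/√n + nδ)`. -/
theorem pair_influence_anticoncentration :
    ∃ C : ℝ, 0 < C ∧
      ∀ (n : ℕ), 2 ≤ n →
        ∀ (f : (Fin n → Bool) → ℝ) (κ δ : ℝ), 0 < κ → 0 < δ →
          ∀ (Ω : Fin n → Set (Fin n → Bool)),
            (∀ (j : Fin n) (ε : Fin n → Bool), 0 ≤ influence f j ε) →
            (∀ (j : Fin n) (hj : (j : ℕ) + 1 < n),
              (∀ ε : Fin n → Bool, ε ∈ Ω j →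
                  κ ≤ pairInfluence f j ⟨(j : ℕ) + 1, hj⟩ ε) ∧
              DependsOnGt (Ω j) ⟨(j : ℕ) + 1, hj⟩ ∧
              1 - δ < mes (Ω j)) →
            ∀ t : ℝ,
              mes {ε : Fin n → Bool | |f ε - t| < κ / 2} ≤
                C * (1 / Real.sqrt n + n * δ) := by
  classical
  refine ⟨6, by norm_num, ?_⟩
  intro n hn f κ δ hκ hδ Ω hinf hpair t
  have hmono := monotone_of_influence_nonneg hinf
  obtain ⟨m, hm⟩ : ∃ m, m = n / 2 := ⟨_, rfl⟩
  let p : Fin m → Fin n := fun i => ⟨2 * i, by omega⟩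
  let q : Fin m → Fin n := fun i => ⟨2 * i + 1, by omega⟩
  have hpq : ∀ i : Fin m, ((p i : Fin n) : ℕ) + 1 < n := fun i => by
    simp only [p]; omega
  have hcover : ∀ k : Fin n, k = ⟨n - 1, by omega⟩ ∨ ∃ i, k = p i ∨ k = q i := by
    intro k
    by_cases hk : (k : ℕ) / 2 < m
    · right
      refine ⟨⟨k / 2, hk⟩, ?_⟩
      simp only [p, q, Fin.ext_iff]
      omega
    · left
      rw [Fin.ext_iff]
      simp only
      omega
  let B : Finset (Fin n → Bool) := {ε | |f ε - t| < κ / 2}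
  let A : Finset (Fin n → Bool) := B.filter fun ε => ∀ i, ε ∈ Ω (p i)
  have hA := card_le_of_no_raised_pair p q _ hcover A (by
    intro x hx y hy hxy i h1 h2 h3 h4
    simp only [A, B, Finset.mem_filter, Finset.mem_univ, true_and, abs_lt] at hx hy
    have h5 := add_pairInfluence_le hmono hxy h1 h2 h3 h4
    have h6 : κ ≤ pairInfluence f (p i) (q i) x := (hpair (p i) (hpq i)).1 x (hx.2 i)
    linarith [hx.1.1, hy.1.2])
  have hBA : B ⊆ A ∪ Finset.univ.biUnion fun i => Finset.univ.filter fun ε => ε ∉ Ω (p i) := by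
    intro x hx
    by_cases h : ∀ i, x ∈ Ω (p i)
    · exact Finset.mem_union_left _ (Finset.mem_filter.mpr ⟨hx, h⟩)
    · push Not at h
      simpa using Or.inr h
  have hcard : (B.card : ℝ) ≤ A.card +
      ∑ i, ((Finset.univ.filter fun ε => ε ∉ Ω (p i)).card : ℝ) := by
    exact_mod_cast (Finset.card_le_card hBA).trans
      ((Finset.card_union_le _ _).trans (Nat.add_le_add_left Finset.card_biUnion_le _))
  have hsum : ∑ i, ((Finset.univ.filter fun ε => ε ∉ Ω (p i)).card : ℝ) ≤ n * (δ * 2 ^ n) := by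
    calc _ ≤ ∑ _i : Fin m, δ * 2 ^ n := Finset.sum_le_sum fun i _ =>
          card_filter_notMem_le_of_lt_mes (hpair (p i) (hpq i)).2.2
      _ = m * (δ * 2 ^ n) := by simp
      _ ≤ n * (δ * 2 ^ n) := by
          gcongr
          omega
  have hmain : 3 * 4 ^ m / √((m : ℝ) + 1) ≤ 6 * (1 / √n) * 2 ^ n := by
    have h1 : (4 : ℝ) ^ m ≤ 2 ^ n := by
      rw [show (4 : ℝ) = 2 ^ 2 by norm_num, ← pow_mul]
      exact pow_le_pow_right₀ (by norm_num) (by omega)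
    have h2 : √(n : ℝ) ≤ 2 * √((m : ℝ) + 1) := by
      rw [Real.sqrt_le_left (by positivity), mul_pow, Real.sq_sqrt (by positivity)]
      have : (n : ℝ) ≤ 2 * m + 1 := by exact_mod_cast (by omega : n ≤ 2 * m + 1)
      have hm0 : (0 : ℝ) ≤ m := by positivity
      linarith
    have hn0 : 0 < √(n : ℝ) := Real.sqrt_pos.mpr (by exact_mod_cast (by omega : 0 < n))
    rw [div_le_iff₀ (by positivity)]
    calc (3 : ℝ) * 4 ^ m ≤ 3 * 2 ^ n := by gcongr
      _ = 3 * 2 ^ n * (1 / √n) * √n := by field_simp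
      _ ≤ 3 * 2 ^ n * (1 / √n) * (2 * √((m : ℝ) + 1)) := by gcongr
      _ = _ := by ring
  have hmes : mes {ε : Fin n → Bool | |f ε - t| < κ / 2} = (B.card : ℝ) / 2 ^ n := by
    unfold mes
    simp only [B, Set.mem_ofPred_eq]
  rw [hmes, div_le_iff₀ (by positivity)]
  have : 0 ≤ (n : ℝ) * (δ * 2 ^ n) := by positivity
  linarith
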